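/- If G and H are finite regular simple graphs, each with at least one edge, and each of G and H contains a perfect matching, then the palette index of the Cartesian product G □ H equals 1. -/

import Mathlib

open SimpleGraph

/-- A proper edge coloring of `G` (colors in `ℕ`): distinct edges sharing a
vertex receive different colors. -/
def IsProperEdgeColoring {V : Type*} (G : SimpleGraph V) (f : Sym2 V → ℕ) : Prop :=
  ∀ e₁ ∈ G.edgeSet, ∀ e₂ ∈ G.edgeSet, e₁ ≠ e₂ → (∃ v, v ∈ e₁ ∧ v ∈ e₂) → f e₁ ≠ f e₂

/-- The palette of a vertex `v` under an edge coloring `f`: the set of colors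
assigned to the edges incident to `v`. -/
def palette {V : Type*} (G : SimpleGraph V) (f : Sym2 V → ℕ) (v : V) : Set ℕ :=
  {c | ∃ e ∈ G.edgeSet, v ∈ e ∧ f e = c}

/-- The number of distinct palettes of vertices of `G` with respect to `f`. -/
noncomputable def numPalettes {V : Type*} (G : SimpleGraph V) (f : Sym2 V → ℕ) : ℕ :=
  (Set.range (palette G f)).ncard

/-- The palette index `š(G)`: the minimum number of distinct vertex palettes
over all proper edge colorings of `G`. -/
noncomputable def paletteIndex {V : Type*} (G : SimpleGraph V) : ℕ :=
  sInf {n | ∃ f, IsProperEdgeColoring G f ∧ numPalettes G f = n}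

/-- The chromatic index `χ'(G)`: the minimum `n` such that `G` has a proper
edge coloring with colors from `{0, …, n-1}`. -/
noncomputable def chromIndex {V : Type*} (G : SimpleGraph V) : ℕ :=
  sInf {n | ∃ f, IsProperEdgeColoring G f ∧ ∀ e ∈ G.edgeSet, f e < n}

/-- The degree of a vertex. -/
noncomputable def vertDegree {V : Type*} (G : SimpleGraph V) (v : V) : ℕ :=
  (G.neighborSet v).ncard

/-- The maximum degree `Δ(G)`. -/
noncomputable def maxDeg {V : Type*} (G : SimpleGraph V) : ℕ :=
  sSup (Set.range (vertDegree G))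

/-- `G` is class 1 if `χ'(G) = Δ(G)`. -/
def IsClass1 {V : Type*} (G : SimpleGraph V) : Prop := chromIndex G = maxDeg G

/-- `G` is `r`-regular. -/
def IsRegularDeg {V : Type*} (G : SimpleGraph V) (r : ℕ) : Prop :=
  ∀ v, vertDegree G v = r

/-- A perfect matching: a set `M` of edges of `G` such that every vertex is
incident to exactly one edge of `M`. -/
def IsPerfectMatchingSet {V : Type*} (G : SimpleGraph V) (M : Set (Sym2 V)) : Prop :=
  M ⊆ G.edgeSet ∧ ∀ v : V, ∃! e, e ∈ M ∧ v ∈ e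

def ECol {V K : Type*} (G : SimpleGraph V) (c : V → V → K) : Prop :=
  (∀ u v, G.Adj u v → c u v = c v u) ∧
    ∀ u v w, G.Adj u v → G.Adj u w → c u v = c u w → v = w

def Miss {V K : Type*} (G : SimpleGraph V) (c : V → V → K) (u : V) (a : K) : Prop :=
  ∀ v, G.Adj u v → c u v ≠ a

inductive FanReach {V K : Type*} (G : SimpleGraph V) (c : V → V → K) (x y0 : V) : ℕ → V → Prop
  | zero : FanReach G c x y0 0 y0
  | succ {n : ℕ} {w z : V} : FanReach G c x y0 n w → G.Adj x z → Miss G c w (c x z) →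
      FanReach G c x y0 (n + 1) z

lemma fan_no_common {V K : Type*} (G : SimpleGraph V) (x y0 : V) (hxy : x ≠ y0)
    (hno : ∀ c : V → V → K, ECol G c → ∀ a, Miss G c x a → ¬ Miss G c y0 a) (n : ℕ) :
    ∀ c : V → V → K, ECol G c → ∀ y, FanReach G c x y0 n y →
      ∀ a, Miss G c x a → ¬ Miss G c y a := by
  classical
  induction n using Nat.strong_induction_on with
  | _ n ih =>
  intro c hc y hy a hx hya
  by_cases hm : ∃ m < n, FanReach G c x y0 m y
  · obtain ⟨m, hmn, hm⟩ := hm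
    exact ih m hmn c hc y hm a hx hya
  push Not at hm
  cases hy with
  | zero => exact hno c hc a hx hya
  | @succ n w _ hw hadj hmiss =>
    have hxy' : x ≠ y := hadj.ne
    let c' : V → V → K := fun u v => if (u = x ∧ v = y) ∨ (u = y ∧ v = x) then a else c u v
    have hc' : ECol G c' := by
      obtain ⟨h1, h2⟩ := hc
      refine ⟨?_, ?_⟩
      · intro u v huv
        have := h1 u v huv
        simp only [c']
        grind
      · intro u v t huv hut
        have e1 := h2 u v t huv hut
        have e2 := hx v
        have e3 := hx t
        have e4 := hya v
        have e5 := hya t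
        simp only [c']
        grind
    have hmono : ∀ j z, FanReach G c x y0 j z → j < n + 1 → FanReach G c' x y0 j z := by
      intro j z hz
      induction hz with
      | zero => intro _; exact .zero
      | @succ j w z hw hz hmz ihw =>
        intro hj
        have hzy : z ≠ y := by
          rintro rfl
          exact hm _ hj (.succ hw hz hmz)
        have hwy : w ≠ y := by
          rintro rfl
          exact hm _ (by omega) hw
        have hwx : w ≠ x := by
          cases hw with
          | zero => exact hxy.symm
          | succ _ h _ => exact h.ne'
        refine .succ (ihw (by omega)) hz ?_
        intro v hv
        have := hmz v hv
        simp only [c']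
        grind
    have hw' := hmono n w hw (by omega)
    have hwy : w ≠ y := by
      rintro rfl
      exact hm _ (by omega) hw
    have hwx : w ≠ x := by
      cases hw with
      | zero => exact hxy.symm
      | succ _ h _ => exact h.ne'
    refine ih n (by omega) c' hc' w hw' (c x y) ?_ ?_
    · intro v hv
      have h2 := hc.2 x v y hv hadj
      have h3 := hx y hadj
      simp only [c']
      grind
    · intro v hv
      have := hmiss v hv
      simp only [c']
      grind

def kempe {V K : Type*} (G : SimpleGraph V) (c : V → V → K) (hc : ECol G c) (a b : K) :
    SimpleGraph V where
  Adj u v := G.Adj u v ∧ (c u v = a ∨ c u v = b)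
  symm := ⟨fun u v h => ⟨h.1.symm, by rw [← hc.1 u v h.1]; exact h.2⟩⟩
  loopless := ⟨fun u h => h.1.ne rfl⟩

lemma fan_chain {V K : Type*} (G : SimpleGraph V) (x y0 : V) (hxy : x ≠ y0)
    (hno : ∀ c : V → V → K, ECol G c → ∀ a, Miss G c x a → ¬ Miss G c y0 a) (n : ℕ)
    (c : V → V → K) (hc : ECol G c) (y : V) (hy : FanReach G c x y0 n y)
    (a b : K) (hx : Miss G c x a) (hb : Miss G c y b) : (kempe G c hc a b).Reachable y x := by
  classical
  by_contra hr
  have hA := fan_no_common G x y0 hxy hno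
  let S : V → Prop := fun v => (kempe G c hc a b).Reachable y v
  have hS : ∀ u v, G.Adj u v → (c u v = a ∨ c u v = b) → (S u ↔ S v) := by
    intro u v h h'
    have h1 : (kempe G c hc a b).Adj u v := ⟨h, h'⟩
    exact ⟨fun h => h.trans h1.reachable, fun h => h.trans h1.symm.reachable⟩
  have hSx : ¬ S x := hr
  have hSy : S y := SimpleGraph.Reachable.refl _
  clear_value S
  let c' : V → V → K := fun u v => if S u then (if c u v = a then b else if c u v = b then a
    else c u v) else c u v
  have hc' : ECol G c' := by
    obtain ⟨h1, h2⟩ := hc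
    refine ⟨?_, ?_⟩
    · intro u v huv
      have e1 := h1 u v huv
      have e2 := hS u v huv
      simp only [c']
      grind
    · intro u v t huv hut
      have e1 := h2 u v t huv hut
      simp only [c']
      grind
  have hxa' : Miss G c' x a := by
    intro v hv
    simpa [c', hSx] using hx v hv
  have hsw : ∀ w, S w → Miss G c w b → Miss G c' w a := by
    intro w hw h v hv
    have := h v hv
    simp only [c']
    grind
  have hmono : ∀ j z, FanReach G c x y0 j z → FanReach G c' x y0 j z := by
    intro j z hz
    induction hz with
    | zero => exact .zero
    | @succ j w z hw hz hmz ihw =>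
      refine .succ ihw hz ?_
      have e : c' x z = c x z := by simp [c', hSx]
      rw [e]
      by_cases hSw : S w
      · have h1 : c x z ≠ a := hx z hz
        have h2 : c x z ≠ b := by
          intro h2
          rw [h2] at hmz
          exact hA j c' hc' w ihw a hxa' (hsw w hSw hmz)
        intro v hv
        have := hmz v hv
        simp only [c']
        grind
      · intro v hv
        simpa [c', hSw] using hmz v hv
  exact hA n c' hc' y (hmono n y hy) a hxa' (hsw y hSy hb)

lemma three_ends {V : Type*} [Finite V] (L : SimpleGraph V) (h2 : ∀ v, (L.neighborSet v).ncard ≤ 2)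
    (x y z : V) (hxy : x ≠ y) (hxz : x ≠ z) (hyz : y ≠ z)
    (hx : (L.neighborSet x).ncard ≤ 1) (hy : (L.neighborSet y).ncard ≤ 1)
    (hz : (L.neighborSet z).ncard ≤ 1) (hyx : L.Reachable y x) (hzx : L.Reachable z x) : False := by
  classical
  have := Fintype.ofFinite V
  let C := L.connectedComponentMk x
  have hconn : C.toSimpleGraph.Connected := C.connected_toSimpleGraph
  have h1 := hconn.card_vert_le_card_edgeSet_add_one
  have hd : ∀ v : C, C.toSimpleGraph.degree v ≤ (L.neighborSet v.1).ncard := by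
    intro v
    rw [← SimpleGraph.card_neighborSet_eq_degree, ← Nat.card_eq_fintype_card]
    apply Nat.card_le_card_of_injective (β := L.neighborSet v.1)
      (fun w : C.toSimpleGraph.neighborSet v => ⟨w.1.1, w.2⟩)
    intro a b hab
    exact Subtype.ext (Subtype.ext (congrArg (fun t => t.1) hab))
  have hsum := C.toSimpleGraph.sum_degrees_eq_twice_card_edges
  let x' : C := ⟨x, rfl⟩
  let y' : C := ⟨y, SimpleGraph.ConnectedComponent.sound hyx⟩
  let z' : C := ⟨z, SimpleGraph.ConnectedComponent.sound hzx⟩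
  have hle : ∑ v : C, (C.toSimpleGraph.degree v + if v ∈ ({x', y', z'} : Finset C) then 1 else 0)
      ≤ ∑ v : C, 2 := by
    apply Finset.sum_le_sum
    intro v _
    have h := hd v
    have h' := h2 v.1
    split_ifs with hv
    · simp only [Finset.mem_insert, Finset.mem_singleton] at hv
      rcases hv with rfl | rfl | rfl
      · have : (L.neighborSet x'.1).ncard ≤ 1 := hx
        omega
      · have : (L.neighborSet y'.1).ncard ≤ 1 := hy
        omega
      · have : (L.neighborSet z'.1).ncard ≤ 1 := hz
        omega
    · omega
  have hcard : ({x', y', z'} : Finset C).card = 3 := by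
    apply Finset.card_eq_three.2
    exact ⟨x', y', z', fun h => hxy (congrArg (fun t => t.1) h),
      fun h => hxz (congrArg (fun t => t.1) h), fun h => hyz (congrArg (fun t => t.1) h), rfl⟩
  rw [Finset.sum_add_distrib, hsum, Finset.sum_boole] at hle
  simp only [Finset.filter_univ_mem, hcard, Finset.sum_const, Finset.card_univ] at hle
  rw [Nat.card_eq_fintype_card, Nat.card_eq_fintype_card, ← SimpleGraph.edgeFinset_card] at h1
  simp at hle
  omega

lemma kempe_deg {V K : Type*} [Finite V] (G : SimpleGraph V) (c : V → V → K) (hc : ECol G c)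
    (a b : K) (v : V) : ((kempe G c hc a b).neighborSet v).ncard ≤ 2 := by
  refine le_trans ?_ (show ({a, b} : Set K).ncard ≤ 2 from
    (Set.ncard_insert_le a {b}).trans (by simp))
  refine Set.ncard_le_ncard_of_injOn (c v) ?_ ?_ (Set.toFinite _)
  · intro w hw
    exact hw.2
  · intro w hw t ht h
    exact hc.2 v w t hw.1 ht.1 h

lemma kempe_deg_miss {V K : Type*} [Finite V] (G : SimpleGraph V) (c : V → V → K) (hc : ECol G c)
    (a b : K) (v : V) (h : Miss G c v a ∨ Miss G c v b) :
    ((kempe G c hc a b).neighborSet v).ncard ≤ 1 := by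
  rw [Set.ncard_le_one_iff]
  intro w t hw ht
  apply hc.2 v w t hw.1 ht.1
  have h1 := hw.2
  have h2 := ht.2
  rcases h with h | h
  · have := h w hw.1
    have := h t ht.1
    grind
  · have := h w hw.1
    have := h t ht.1
    grind

lemma card_miss {V K : Type*} [Finite V] [Fintype K] (G : SimpleGraph V) (c : V → V → K)
    (hc : ECol G c) (v : V) [DecidablePred (Miss G c v)] :
    (Finset.univ.filter (Miss G c v)).card + (G.neighborSet v).ncard = Fintype.card K := by
  classical
  have h : (G.neighborSet v).ncard = (c v '' G.neighborSet v).ncard := by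
    rw [Set.InjOn.ncard_image]
    intro w hw t ht h
    exact hc.2 v w t hw ht h
  have h2 : (Finset.univ.filter (Miss G c v)).card = ((c v '' G.neighborSet v)ᶜ).ncard := by
    rw [← Set.ncard_coe_finset]
    congr 1
    ext a
    simp [Miss]
  rw [h, h2, add_comm, Set.ncard_add_ncard_compl, Nat.card_eq_fintype_card]

lemma vizing_step {V K : Type*} [Finite V] [Fintype K] (G : SimpleGraph V) (x y0 : V)
    (hxy : x ≠ y0) (hn : ¬ G.Adj x y0) (hdeg : ∀ v, (G.neighborSet v).ncard < Fintype.card K)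
    (hy0 : (G.neighborSet y0).ncard + 1 < Fintype.card K) (c : V → V → K) (hc : ECol G c) :
    ∃ c : V → V → K, ECol G c ∧ ∃ a, Miss G c x a ∧ Miss G c y0 a := by
  classical
  have := Fintype.ofFinite V
  by_contra hcon
  have hno : ∀ c : V → V → K, ECol G c → ∀ a, Miss G c x a → ¬ Miss G c y0 a := by
    intro c hc a h1 h2
    exact hcon ⟨c, hc, a, h1, h2⟩
  let F : Finset V := Finset.univ.filter (fun y => ∃ n, FanReach G c x y0 n y)
  let m : V → Finset K := fun v => Finset.univ.filter (Miss G c v)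
  have hm1 : ∀ v, 1 ≤ (m v).card := by
    intro v
    have := card_miss G c hc v
    have := hdeg v
    simp only [m]
    omega
  have hm2 : 2 ≤ (m y0).card := by
    have := card_miss G c hc y0
    simp only [m]
    omega
  have hy0F : y0 ∈ F := by simp only [F, Finset.mem_filter_univ]; exact ⟨0, .zero⟩
  have hFx : ∀ y ∈ F, x ≠ y := by
    intro y hy
    simp only [F, Finset.mem_filter_univ] at hy
    obtain ⟨n, hy⟩ := hy
    cases hy with
    | zero => exact hxy
    | succ _ h _ => exact h.ne
  obtain ⟨a, ha⟩ := Finset.card_pos.1 (hm1 x)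
  simp only [m, Finset.mem_filter_univ] at ha
  have hdisj : (F : Set V).PairwiseDisjoint m := by
    intro y hy z hz hyz
    change Disjoint (m y) (m z)
    rw [Finset.disjoint_left]
    intro b hby hbz
    have hxy := hFx y hy
    have hxz := hFx z hz
    simp only [F, Finset.coe_filter, Finset.mem_univ, true_and, Set.mem_setOf_eq] at hy hz
    simp only [m, Finset.mem_filter_univ] at hby hbz
    obtain ⟨i, hy⟩ := hy
    obtain ⟨j, hz⟩ := hz
    exact three_ends (kempe G c hc a b) (kempe_deg G c hc a b) x y z hxy hxz hyz
      (kempe_deg_miss G c hc a b x (.inl ha)) (kempe_deg_miss G c hc a b y (.inr hby))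
      (kempe_deg_miss G c hc a b z (.inr hbz))
      (fan_chain G x y0 ‹_› hno i c hc y hy a b ha hby)
      (fan_chain G x y0 ‹_› hno j c hc z hz a b ha hbz)
  have hsub : F.biUnion m ⊆ (F.erase y0).image (c x) := by
    intro b hb
    simp only [Finset.mem_biUnion, m, F, Finset.mem_filter_univ] at hb
    obtain ⟨y, ⟨n, hy⟩, hb⟩ := hb
    have hnx : ¬ Miss G c x b := fun h => fan_no_common G x y0 hxy hno n c hc y hy b h hb
    simp only [Miss, not_forall, not_not] at hnx
    obtain ⟨z, hz, rfl⟩ := hnx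
    refine Finset.mem_image.2 ⟨z, ?_, rfl⟩
    simp only [Finset.mem_erase, F, Finset.mem_filter_univ]
    refine ⟨?_, n + 1, .succ hy hz hb⟩
    rintro rfl
    exact hn hz
  have h1 := (Finset.card_le_card hsub).trans Finset.card_image_le
  rw [Finset.card_biUnion hdisj, ← Finset.add_sum_erase F _ hy0F] at h1
  have h3 : (F.erase y0).card ≤ ∑ v ∈ F.erase y0, (m v).card := by
    rw [Finset.card_eq_sum_ones]
    exact Finset.sum_le_sum fun v _ => hm1 v
  omega

theorem vizing {V K : Type*} [Finite V] [Fintype K] (G : SimpleGraph V)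
    (hdeg : ∀ v, (G.neighborSet v).ncard < Fintype.card K) : ∃ c : V → V → K, ECol G c := by
  classical
  induction G using WellFoundedLT.induction with
  | _ G ih =>
  by_cases hG : ∃ x y, G.Adj x y
  · obtain ⟨x, y, hxy⟩ := hG
    let G' := G.deleteEdges {s(x, y)}
    have hadj : ∀ u v, G'.Adj u v ↔ G.Adj u v ∧ ¬ ((u = x ∧ v = y) ∨ (u = y ∧ v = x)) := by
      intro u v
      simp [G', SimpleGraph.deleteEdges_adj]
    have hle : G' ≤ G := G.deleteEdges_le _
    have hlt : G' < G := by
      refine lt_of_le_of_ne hle ?_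
      intro h
      have := (hadj x y).1 (h ▸ hxy)
      simp at this
    have hsub : ∀ v, G'.neighborSet v ⊆ G.neighborSet v := fun v w hw => hle hw
    have hd : ∀ v, (G'.neighborSet v).ncard < Fintype.card K := fun v =>
      lt_of_le_of_lt (Set.ncard_le_ncard (hsub v)) (hdeg v)
    have hdy : (G'.neighborSet y).ncard + 1 < Fintype.card K := by
      refine lt_of_le_of_lt ?_ (hdeg y)
      apply Set.ncard_lt_ncard (ht := Set.toFinite _)
      refine ⟨hsub y, fun h => ?_⟩
      have := (hadj y x).1 (h hxy.symm)
      simp at this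
    obtain ⟨c, hc⟩ := ih G' hlt hd
    have hnot : ¬ G'.Adj x y := by simp [hadj]
    obtain ⟨c, hc, a, hx, hy⟩ := vizing_step G' x y hxy.ne hnot hd hdy c hc
    refine ⟨fun u v => if (u = x ∧ v = y) ∨ (u = y ∧ v = x) then a else c u v, ?_, ?_⟩
    · intro u v huv
      have := hc.1 u v
      rw [hadj] at this
      grind
    · intro u v t huv hut
      have e1 := hc.2 u v t
      have e2 := hx v
      have e3 := hx t
      have e4 := hy v
      have e5 := hy t
      have := hxy.ne
      rw [hadj] at e2 e3 e4 e5
      rw [hadj, hadj] at e1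
      grind
  · push Not at hG
    rcases isEmpty_or_nonempty V with hV | ⟨⟨v⟩⟩
    · exact ⟨fun u => (hV.false u).elim, fun u => (hV.false u).elim, fun u => (hV.false u).elim⟩
    · have : 0 < Fintype.card K := by have := hdeg v; omega
      obtain ⟨k⟩ := Fintype.card_pos_iff.1 this
      exact ⟨fun _ _ => k, fun u v h => (hG u v h).elim, fun u v w h => (hG u v h).elim⟩

/-- A regular graph minus a perfect matching, coloured with unique missing colours. -/
lemma matching_colour {V : Type*} [Finite V] (G : SimpleGraph V) (r : ℕ) (hr : IsRegularDeg G r)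
    (M : Set (Sym2 V)) (hM : IsPerfectMatchingSet G M) :
    ∃ (c : V → V → ℕ) (m : V → ℕ), (∀ u v, c u v = c v u) ∧
      (∀ u v, G.Adj u v → s(u, v) ∉ M → c u v < r) ∧ (∀ u, m u < r) ∧
      (∀ u v w, G.Adj u v → s(u, v) ∉ M → G.Adj u w → s(u, w) ∉ M → c u v = c u w → v = w) ∧
      (∀ u v, G.Adj u v → s(u, v) ∉ M → c u v ≠ m u) ∧
      (∀ u i, i < r → i ≠ m u → ∃ v, G.Adj u v ∧ s(u, v) ∉ M ∧ c u v = i) := by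
  classical
  let G' := G.deleteEdges M
  have hadj : ∀ u v, G'.Adj u v ↔ G.Adj u v ∧ s(u, v) ∉ M := by
    intro u v
    simp [G', SimpleGraph.deleteEdges_adj]
  have hd : ∀ v, (G'.neighborSet v).ncard + 1 = r := by
    intro v
    obtain ⟨e, ⟨heM, hve⟩, huniq⟩ := hM.2 v
    obtain ⟨w, rfl⟩ := Sym2.mem_iff_exists.1 hve
    have hvw : G.Adj v w := hM.1 heM
    have : G'.neighborSet v = G.neighborSet v \ {w} := by
      ext t
      simp only [SimpleGraph.mem_neighborSet, hadj, Set.mem_diff, Set.mem_singleton_iff]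
      constructor
      · rintro ⟨h1, h2⟩
        exact ⟨h1, by rintro rfl; exact h2 heM⟩
      · rintro ⟨h1, h2⟩
        refine ⟨h1, fun h => h2 ?_⟩
        have := huniq s(v, t) ⟨h, Sym2.mem_mk_left _ _⟩
        exact Sym2.congr_right.1 this
    rw [this, Set.ncard_diff_singleton_add_one (by exact hvw)]
    exact hr v
  obtain ⟨c, hc⟩ := vizing (K := Fin r) G' (by intro v; have := hd v; simp; omega)
  have hmiss : ∀ v, ∃ a, ∀ b, Miss G' c v b ↔ b = a := by
    intro v
    have h1 := card_miss G' c hc v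
    have h2 := hd v
    rw [Fintype.card_fin] at h1
    obtain ⟨a, ha⟩ := Finset.card_eq_one.1 (show (Finset.univ.filter (Miss G' c v)).card = 1 by omega)
    refine ⟨a, fun b => ?_⟩
    have := congrArg (b ∈ ·) ha
    simpa using this
  choose m hm using hmiss
  refine ⟨fun u v => if G'.Adj u v then (c u v : ℕ) else 0, fun u => m u, ?_, ?_, ?_, ?_, ?_, ?_⟩
  · intro u v
    by_cases h : G'.Adj u v
    · simp [h, h.symm, hc.1 u v h]
    · have h' : ¬ G'.Adj v u := fun h' => h h'.symm
      simp [h, h']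
  · intro u v h1 h2
    simp [(hadj u v).2 ⟨h1, h2⟩]
  · intro u
    exact (m u).2
  · intro u v w h1 h2 h3 h4
    have e1 := (hadj u v).2 ⟨h1, h2⟩
    have e2 := (hadj u w).2 ⟨h3, h4⟩
    simp only [e1, e2, if_true]
    intro h
    exact hc.2 u v w e1 e2 (Fin.ext h)
  · intro u v h1 h2
    have e1 := (hadj u v).2 ⟨h1, h2⟩
    simp only [e1, if_true]
    intro h
    exact (hm u (m u)).2 rfl v e1 (Fin.ext h)
  · intro u i hi him
    have h : ¬ Miss G' c u ⟨i, hi⟩ := by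
      rw [hm]
      intro h
      exact him (congrArg Fin.val h)
    simp only [Miss, not_forall, not_not] at h
    obtain ⟨v, hv, hvi⟩ := h
    refine ⟨v, ((hadj u v).1 hv).1, ((hadj u v).1 hv).2, ?_⟩
    simp [hv, hvi]

lemma matching_partner {V : Type*} (G : SimpleGraph V) (M : Set (Sym2 V))
    (hM : IsPerfectMatchingSet G M) (u : V) :
    ∃ v, G.Adj u v ∧ s(u, v) ∈ M ∧ ∀ w, s(u, w) ∈ M → w = v := by
  obtain ⟨e, ⟨heM, hve⟩, huniq⟩ := hM.2 u
  obtain ⟨w, rfl⟩ := Sym2.mem_iff_exists.1 hve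
  refine ⟨w, hM.1 heM, heM, fun t ht => ?_⟩
  have := huniq s(u, t) ⟨ht, Sym2.mem_mk_left _ _⟩
  exact Sym2.congr_right.1 this

/-- If `G` and `H` are finite regular simple graphs, each with at
least one edge and each containing a perfect matching, then `š(G □ H) = 1`. -/
theorem paletteIndex_boxProd_eq_one_of_perfectMatchings {V W : Type*} [Fintype V] [Fintype W]
    (G : SimpleGraph V) (H : SimpleGraph W)
    (hGreg : ∃ r, IsRegularDeg G r) (hHreg : ∃ r, IsRegularDeg H r)
    (hGe : G.edgeSet.Nonempty) (hHe : H.edgeSet.Nonempty)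
    (hGM : ∃ M, IsPerfectMatchingSet G M) (hHM : ∃ M, IsPerfectMatchingSet H M) :
    paletteIndex (G □ H) = 1 := by
  classical
  obtain ⟨r, hr⟩ := hGreg
  obtain ⟨s, hs⟩ := hHreg
  obtain ⟨M, hM⟩ := hGM
  obtain ⟨N, hN⟩ := hHM
  have hne : Nonempty (V × W) := by
    obtain ⟨e, -⟩ := hGe
    obtain ⟨e', -⟩ := hHe
    exact ⟨(e.out.1, e'.out.1)⟩
  obtain ⟨c, m, c1, c2, c3, c4, c5, c6⟩ := matching_colour G r hr M hM
  obtain ⟨d, n, d1, d2, d3, d4, d5, d6⟩ := matching_colour H s hs N hN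
  have hMp := matching_partner G M hM
  have hNp := matching_partner H N hN
  let g : V × W → V × W → ℕ := fun p q =>
    if p.2 = q.2 then (if s(p.1, q.1) ∈ M then r + n p.2 else c p.1 q.1)
    else if p.1 = q.1 then (if s(p.2, q.2) ∈ N then m p.1 else r + d p.2 q.2) else 0
  have hg : ∀ p q, g p q = g q p := by
    rintro ⟨u, v⟩ ⟨u', v'⟩
    simp only [g]
    rw [c1 u u', d1 v v', Sym2.eq_swap (a := u), Sym2.eq_swap (a := v)]
    grind
  let f : Sym2 (V × W) → ℕ := Sym2.lift ⟨g, hg⟩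
  have hf : ∀ p q, f s(p, q) = g p q := fun p q => rfl
  have hadj : ∀ u v u' v', (G □ H).Adj (u, v) (u', v') ↔
      G.Adj u u' ∧ v = v' ∨ H.Adj v v' ∧ u = u' := by
    intro u v u' v'
    simp [SimpleGraph.boxProd_adj]
  have hproper : IsProperEdgeColoring (G □ H) f := by
    intro e₁ h₁ e₂ h₂ hne ⟨p, hp1, hp2⟩ heq
    obtain ⟨q1, rfl⟩ := Sym2.mem_iff_exists.1 hp1
    obtain ⟨q2, rfl⟩ := Sym2.mem_iff_exists.1 hp2
    apply hne
    congr 1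
    rw [hf, hf] at heq
    rw [SimpleGraph.mem_edgeSet] at h₁ h₂
    obtain ⟨u, v⟩ := p
    obtain ⟨u1, v1⟩ := q1
    obtain ⟨u2, v2⟩ := q2
    rw [hadj] at h₁ h₂
    simp only [g] at heq
    obtain ⟨uM, hu1, hu2, hu3⟩ := hMp u
    obtain ⟨vN, hv1, hv2, hv3⟩ := hNp v
    have k1 := c2 u u1
    have k2 := c2 u u2
    have k3 := c3 u
    have k4 := c4 u u1 u2
    have k5 := c5 u u1
    have k6 := c5 u u2
    have l1 := d2 v v1
    have l2 := d2 v v2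
    have l3 := d3 v
    have l4 := d4 v v1 v2
    have l5 := d5 v v1
    have l6 := d5 v v2
    have i1 := hu3 u1
    have i2 := hu3 u2
    have j1 := hv3 v1
    have j2 := hv3 v2
    clear_value g f
    clear hf hadj hne hp1 hp2 c1 c2 c3 c4 c5 c6 d1 d2 d3 d4 d5 d6 hMp hNp
    rcases h₁ with ⟨a1, rfl⟩ | ⟨a1, rfl⟩ <;> rcases h₂ with ⟨a2, rfl⟩ | ⟨a2, rfl⟩
    · grind
    · have := a2.ne
      grind
    · have := a1.ne
      grind
    · have := a1.ne
      have := a2.ne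
      grind
  have hpal : ∀ p, palette (G □ H) f p = {i | i < r + s} := by
    rintro ⟨u, v⟩
    ext i
    simp only [palette, Set.mem_setOf_eq]
    constructor
    · rintro ⟨e, he, hpe, rfl⟩
      obtain ⟨⟨u1, v1⟩, rfl⟩ := Sym2.mem_iff_exists.1 hpe
      rw [SimpleGraph.mem_edgeSet, hadj] at he
      rw [hf]
      simp only [g]
      have k1 := c2 u u1
      have k3 := c3 u
      have l1 := d2 v v1
      have l3 := d3 v
      rcases he with ⟨a1, rfl⟩ | ⟨a1, rfl⟩
      · grind
      · have := a1.ne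
        grind
    · intro hi
      suffices h : ∃ q, (G □ H).Adj (u, v) q ∧ g (u, v) q = i by
        obtain ⟨q, hq, hqi⟩ := h
        exact ⟨s((u, v), q), hq, Sym2.mem_mk_left _ _, hqi⟩
      by_cases hir : i < r
      · by_cases him : i = m u
        · obtain ⟨vN, hv1, hv2, hv3⟩ := hNp v
          refine ⟨(u, vN), (hadj _ _ _ _).2 (.inr ⟨hv1, rfl⟩), ?_⟩
          simp [g, hv1.ne, hv2, him]
        · obtain ⟨w, hw1, hw2, hw3⟩ := c6 u i hir him
          refine ⟨(w, v), (hadj _ _ _ _).2 (.inl ⟨hw1, rfl⟩), ?_⟩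
          simp [g, hw2, hw3]
      · by_cases him : i - r = n v
        · obtain ⟨uM, hu1, hu2, hu3⟩ := hMp u
          refine ⟨(uM, v), (hadj _ _ _ _).2 (.inl ⟨hu1, rfl⟩), ?_⟩
          simp [g, hu2]
          omega
        · obtain ⟨w, hw1, hw2, hw3⟩ := d6 v (i - r) (by omega) him
          refine ⟨(u, w), (hadj _ _ _ _).2 (.inr ⟨hw1, rfl⟩), ?_⟩
          simp [g, hw1.ne, hw2, hw3]
          omega
  have hnum : numPalettes (G □ H) f = 1 := by
    have : palette (G □ H) f = fun _ => {i | i < r + s} := funext hpal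
    rw [numPalettes, this, Set.range_const, Set.ncard_singleton]
  apply le_antisymm
  · exact Nat.sInf_le ⟨f, hproper, hnum⟩
  · refine le_csInf (s := {n | ∃ f, IsProperEdgeColoring (G □ H) f ∧ numPalettes (G □ H) f = n})
      ⟨1, f, hproper, hnum⟩ ?_
    rintro k ⟨f', -, rfl⟩
    exact (Set.ncard_pos (Set.finite_range _)).2 (Set.range_nonempty _)
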